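/- Stone-parity formula: let n ≥ 0, let g₁, …, gₙ each be an arbitrary product of the matrices α, β, γ and their inverses, let T₁, …, Tₙ each be one of the eleven tile boundary matrices B₁, B₂, B₃, S₁, S₂, N₁, …, N₆, and let k be the number of indices i with Tᵢ ∈ {S₁, S₂}. Then the product (g₁·T₁·g₁⁻¹)·(g₂·T₂·g₂⁻¹)·⋯·(gₙ·Tₙ·gₙ⁻¹) equals (−1)^k · I; i.e., the boundary product records the parity of the number of stones used. -/

import Mathlib

open Matrix

/-- `ω = exp(2πi/12)`, a primitive 12th root of unity. -/
noncomputable def ω : ℂ := Complex.exp (2 * Real.pi * Complex.I / 12)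

/-- The SL₂(ℂ) connection matrix on northeast edges. -/
noncomputable def α : Matrix (Fin 2) (Fin 2) ℂ := !![ω^7, 0; 0, ω^5]

/-- The SL₂(ℂ) connection matrix on northwest edges. -/
noncomputable def β : Matrix (Fin 2) (Fin 2) ℂ := !![ω^7, ω^3; 0, ω^5]

/-- The SL₂(ℂ) connection matrix on horizontal edges. -/
noncomputable def γ : Matrix (Fin 2) (Fin 2) ℂ := !![ω^5, 0; ω^3, ω^7]

/-- The length-two move `X = β·α`. -/
noncomputable def X : Matrix (Fin 2) (Fin 2) ℂ := β * α

/-- The length-two move `Y = α⁻¹·γ`. -/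
noncomputable def Y : Matrix (Fin 2) (Fin 2) ℂ := α⁻¹ * γ

/-- The length-two move `Z = γ⁻¹·β⁻¹`. -/
noncomputable def Z : Matrix (Fin 2) (Fin 2) ℂ := γ⁻¹ * β⁻¹

/-- `x = X⁻¹`. -/
noncomputable def x : Matrix (Fin 2) (Fin 2) ℂ := X⁻¹

/-- `y = Y⁻¹`. -/
noncomputable def y : Matrix (Fin 2) (Fin 2) ℂ := Y⁻¹

/-- `z = Z⁻¹`. -/
noncomputable def z : Matrix (Fin 2) (Fin 2) ℂ := Z⁻¹

/-- Bone boundary word `B₁ = Z·Z·Z·Y·z·z·X`. -/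
noncomputable def B₁ : Matrix (Fin 2) (Fin 2) ℂ := Z * Z * Z * Y * z * z * X

/-- Bone boundary word `B₂ = Z·x·x·Y·X·X·X`. -/
noncomputable def B₂ : Matrix (Fin 2) (Fin 2) ℂ := Z * x * x * Y * X * X * X

/-- Bone boundary word `B₃ = Z·Y·Y·Y·X·y·y`. -/
noncomputable def B₃ : Matrix (Fin 2) (Fin 2) ℂ := Z * Y * Y * Y * X * y * y

/-- Stone boundary word `S₁ = Z·Z·Y·Y·X·X`. -/
noncomputable def S₁ : Matrix (Fin 2) (Fin 2) ℂ := Z * Z * Y * Y * X * X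

/-- Stone boundary word `S₂ = y·Z·x·Y·z·X`. -/
noncomputable def S₂ : Matrix (Fin 2) (Fin 2) ℂ := y * Z * x * Y * z * X

/-- Snake boundary word `N₁ = Z·y·Z·Z·Y·z·Y·z·X`. -/
noncomputable def N₁ : Matrix (Fin 2) (Fin 2) ℂ := Z * y * Z * Z * Y * z * Y * z * X

/-- Snake boundary word `N₂ = Z·x·Z·x·Y·X·z·X·X`. -/
noncomputable def N₂ : Matrix (Fin 2) (Fin 2) ℂ := Z * x * Z * x * Y * X * z * X * X

/-- Snake boundary word `N₃ = y·Z·y·Z·Y·Y·z·Y·X`. -/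
noncomputable def N₃ : Matrix (Fin 2) (Fin 2) ℂ := y * Z * y * Z * Y * Y * z * Y * X

/-- Snake boundary word `N₄ = Z·Z·x·Z·Y·z·X·z·X`. -/
noncomputable def N₄ : Matrix (Fin 2) (Fin 2) ℂ := Z * Z * x * Z * Y * z * X * z * X

/-- Snake boundary word `N₅ = Z·x·Y·x·Y·X·X·y·X`. -/
noncomputable def N₅ : Matrix (Fin 2) (Fin 2) ℂ := Z * x * Y * x * Y * X * X * y * X

/-- Snake boundary word `N₆ = y·Z·Y·x·Y·Y·X·y·X`. -/
noncomputable def N₆ : Matrix (Fin 2) (Fin 2) ℂ := y * Z * Y * x * Y * Y * X * y * X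

/-- The eleven tile boundary matrices: three bones, two stones, six snakes. -/
noncomputable def tileBoundaries : Set (Matrix (Fin 2) (Fin 2) ℂ) :=
  {B₁, B₂, B₃, S₁, S₂, N₁, N₂, N₃, N₄, N₅, N₆}

/-- The nine bone and snake boundary matrices. -/
noncomputable def boneSnakeBoundaries : Set (Matrix (Fin 2) (Fin 2) ℂ) :=
  {B₁, B₂, B₃, N₁, N₂, N₃, N₄, N₅, N₆}

lemma omega_pow_four : ω ^ 4 = ω ^ 2 - 1 := by
  have h6 : ω ^ 6 = -1 := by
    rw [ω, ← Complex.exp_nat_mul, ← Complex.exp_pi_mul_I]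
    congr 1
    push_cast
    ring
  have h2 : ω ^ 2 ≠ -1 := by
    rw [ω, ← Complex.exp_nat_mul]
    intro h
    have hre := congrArg Complex.re h
    have harg : ((2 : ℕ) : ℂ) * (2 * Real.pi * Complex.I / 12)
        = ((Real.pi / 3 : ℝ) : ℂ) * Complex.I := by
      push_cast
      ring
    rw [harg, Complex.exp_ofReal_mul_I_re, Real.cos_pi_div_three] at hre
    norm_num at hre
  have h : (ω ^ 2 + 1) * (ω ^ 4 - ω ^ 2 + 1) = 0 := by linear_combination h6
  rcases mul_eq_zero.mp h with h | h
  · exact absurd (eq_neg_of_add_eq_zero_left h) h2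
  · linear_combination h

lemma det_alpha : α.det = 1 := by
  simp only [α, det_fin_two_of]
  grind [omega_pow_four]

lemma det_beta : β.det = 1 := by
  simp only [β, det_fin_two_of]
  grind [omega_pow_four]

lemma det_gamma : γ.det = 1 := by
  simp only [γ, det_fin_two_of]
  grind [omega_pow_four]

/-- The inverse of a `2 × 2` matrix of determinant one is its adjugate. -/
lemma inv_fin_two_of_det_eq_one {a b c d : ℂ} (h : a * d - b * c = 1) :
    (!![a, b; c, d])⁻¹ = !![d, -b; -c, a] := by
  rw [Matrix.inv_def, det_fin_two_of, h, adjugate_fin_two_of]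
  simp

lemma fin_two_of_congr {a b c d a' b' c' d' : ℂ} (ha : a = a') (hb : b = b') (hc : c = c')
    (hd : d = d') : !![a, b; c, d] = !![a', b'; c', d'] := by
  rw [ha, hb, hc, hd]

lemma X_eq : X = !![ω ^ 2, -ω ^ 2; 0, 1 - ω ^ 2] := by
  simp only [X, α, β, mul_fin_two]
  apply fin_two_of_congr <;> grind [omega_pow_four]

lemma Y_eq : Y = !![1 - ω ^ 2, 0; 1 - ω ^ 2, ω ^ 2] := by
  rw [Y, α, inv_fin_two_of_det_eq_one (by grind [omega_pow_four])]
  simp only [γ, mul_fin_two]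
  apply fin_two_of_congr <;> grind [omega_pow_four]

lemma Z_eq : Z = !![1, ω ^ 2 - 1; ω ^ 2, 0] := by
  rw [Z, γ, β, inv_fin_two_of_det_eq_one (by grind [omega_pow_four]),
    inv_fin_two_of_det_eq_one (by grind [omega_pow_four])]
  simp only [mul_fin_two]
  apply fin_two_of_congr <;> grind [omega_pow_four]

lemma x_eq : x = !![1 - ω ^ 2, ω ^ 2; 0, ω ^ 2] := by
  rw [x, X_eq, inv_fin_two_of_det_eq_one (by grind [omega_pow_four])]
  simp

lemma y_eq : y = !![ω ^ 2, 0; ω ^ 2 - 1, 1 - ω ^ 2] := by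
  rw [y, Y_eq, inv_fin_two_of_det_eq_one (by grind [omega_pow_four])]
  simp

lemma z_eq : z = !![0, 1 - ω ^ 2; -ω ^ 2, 1] := by
  rw [z, Z_eq, inv_fin_two_of_det_eq_one (by grind [omega_pow_four])]
  simp

/-- The bones and snakes have trivial boundary. -/
lemma eq_one_of_mem_boneSnakeBoundaries {T : Matrix (Fin 2) (Fin 2) ℂ}
    (hT : T ∈ boneSnakeBoundaries) : T = 1 := by
  have h := omega_pow_four
  simp only [boneSnakeBoundaries, Set.mem_insert_iff, Set.mem_singleton_iff] at hT
  rcases hT with rfl | rfl | rfl | rfl | rfl | rfl | rfl | rfl | rfl <;>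
    simp only [B₁, B₂, B₃, N₁, N₂, N₃, N₄, N₅, N₆, X_eq, Y_eq, Z_eq, x_eq, y_eq, z_eq,
      mul_fin_two, one_fin_two] <;>
    apply fin_two_of_congr <;> grind

/-- The stones have boundary `-1`. -/
lemma eq_neg_one_of_stone {T : Matrix (Fin 2) (Fin 2) ℂ} (hT : T = S₁ ∨ T = S₂) : T = -1 := by
  have h := omega_pow_four
  rcases hT with rfl | rfl <;>
    simp only [S₁, S₂, X_eq, Y_eq, Z_eq, x_eq, y_eq, z_eq, mul_fin_two, one_fin_two, neg_of,
      neg_cons, neg_empty] <;>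
    apply fin_two_of_congr <;> grind

lemma isUnit_det_of_mem_closure {g : Matrix (Fin 2) (Fin 2) ℂ}
    (hg : g ∈ Submonoid.closure
      ({α, β, γ, α⁻¹, β⁻¹, γ⁻¹} : Set (Matrix (Fin 2) (Fin 2) ℂ))) : IsUnit g.det := by
  induction hg using Submonoid.closure_induction with
  | mem g h =>
    rcases h with rfl | rfl | rfl | rfl | rfl | rfl <;>
      simp [det_nonsing_inv, det_alpha, det_beta, det_gamma]
  | one => simp
  | mul a b _ _ ha hb =>
    rw [det_mul]
    exact ha.mul hb

open scoped Classical in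
/-- Stone-parity formula: a product of conjugated tile boundary matrices equals
`(-1)^k · I`, where `k` is the number of stones used. -/
theorem stone_parity (n : ℕ) (k : ℕ)
    (g T : Fin n → Matrix (Fin 2) (Fin 2) ℂ)
    (hg : ∀ i, g i ∈ Submonoid.closure
      ({α, β, γ, α⁻¹, β⁻¹, γ⁻¹} : Set (Matrix (Fin 2) (Fin 2) ℂ)))
    (hT : ∀ i, T i ∈ tileBoundaries)
    (hk : (Finset.univ.filter fun i => T i = S₁ ∨ T i = S₂).card = k) :
    (List.ofFn fun i => g i * T i * (g i)⁻¹).prod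
      = ((-1 : ℂ)^k) • (1 : Matrix (Fin 2) (Fin 2) ℂ) := by
  have hconj (i : Fin n) : g i * T i * (g i)⁻¹
      = algebraMap ℂ _ (if T i = S₁ ∨ T i = S₂ then (-1 : ℂ) else 1) := by
    have hunit := isUnit_det_of_mem_closure (hg i)
    have hTi := hT i
    split_ifs with h
    · rw [eq_neg_one_of_stone h, mul_neg_one, neg_mul, mul_nonsing_inv _ hunit, map_neg, map_one]
    · rw [eq_one_of_mem_boneSnakeBoundaries (T := T i), mul_one, mul_nonsing_inv _ hunit, map_one]
      simp only [tileBoundaries, boneSnakeBoundaries, Set.mem_insert_iff,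
        Set.mem_singleton_iff] at hTi ⊢
      grind only
  simp only [hconj]
  rw [← Function.comp_def (algebraMap ℂ (Matrix (Fin 2) (Fin 2) ℂ)), ← List.map_ofFn,
    ← map_list_prod, List.prod_ofFn, Finset.prod_ite, Finset.prod_const, Finset.prod_const_one,
    mul_one, hk, Algebra.algebraMap_eq_smul_one]
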